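/- The price competition game with two buyer types ℓ and r of volume 1 each and two non-abstain vendors L and R, both with production cost 0, where the valuations are v_{ℓL} = v_{rR} = 5 and v_{ℓR} = v_{rL} = 3 (and the abstain option is available), admits no equilibrium: there is no pair of a price vector and a consistent buyers-to-vendors assignment forming an equilibrium. -/

import Mathlib

open Finset

/-- A price competition game with buyer types `N` and vendors `M`
(including the special "abstain" vendor). -/
structure PCGame (N M : Type) [Fintype N] [Fintype M] where
  abstain : M
  μ : N → ℝ
  v : N → M → ℝ
  c : M → ℝ
  μ_pos : ∀ i, 0 < μ i
  v_nonneg : ∀ i j, 0 ≤ v i j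
  c_nonneg : ∀ j, 0 ≤ c j
  v_abstain : ∀ i, v i abstain = 0
  c_abstain : c abstain = 0

namespace PCGame

variable {N M : Type} [Fintype N] [Fintype M]

/-- `p` is a valid price vector: every price is at least the production cost and
the abstain vendor has price `0`. -/
def IsPrice (G : PCGame N M) (p : M → ℝ) : Prop :=
  (∀ j, G.c j ≤ p j) ∧ p G.abstain = 0

/-- `x` is a valid buyers-to-vendors assignment. -/
def IsAssignment (G : PCGame N M) (x : N → M → ℝ) : Prop :=
  (∀ i j, 0 ≤ x i j) ∧ ∀ i, ∑ j, x i j = G.μ i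

/-- `x` is consistent to `p`: positive volume goes only to utility-maximizing vendors. -/
def Consistent (G : PCGame N M) (x : N → M → ℝ) (p : M → ℝ) : Prop :=
  ∀ i j, 0 < x i j → ∀ j', G.v i j' - p j' ≤ G.v i j - p j

/-- Utility of vendor `j` under assignment `x` and prices `p`. -/
noncomputable def util (G : PCGame N M) (x : N → M → ℝ) (p : M → ℝ) (j : M) : ℝ :=
  (p j - G.c j) * ∑ i, x i j

/-- Total utility of the buyers of type `i`. -/
noncomputable def buyerUtil (G : PCGame N M) (x : N → M → ℝ) (p : M → ℝ) (i : N) : ℝ :=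
  ∑ j, x i j * (G.v i j - p j)

/-- `(x, p)` is a (pure Nash) equilibrium: `x` is consistent to `p` and no (non-abstain)
vendor can increase its utility by deviating to another price. -/
def IsEquilibrium [DecidableEq M] (G : PCGame N M) (x : N → M → ℝ) (p : M → ℝ) : Prop :=
  G.IsPrice p ∧ G.IsAssignment x ∧ G.Consistent x p ∧
    ∀ j, j ≠ G.abstain → ∀ p' : ℝ, G.c j ≤ p' →
      ∀ y, G.IsAssignment y → G.Consistent y (Function.update p j p') →
        G.util y (Function.update p j p') j ≤ G.util x p j

/-- Social welfare of assignment `x`. -/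
noncomputable def SW (G : PCGame N M) (x : N → M → ℝ) : ℝ :=
  ∑ i, ∑ j, x i j * (G.v i j - G.c j)

/-- Optimal social welfare. -/
noncomputable def SWopt (G : PCGame N M) : ℝ :=
  ∑ i, G.μ i * Finset.univ.sup' ⟨G.abstain, Finset.mem_univ _⟩ (fun j => G.v i j - G.c j)

/-- `θ_j(p)`: the supremum utility of vendor `j` over all of its price deviations
(the abstain vendor cannot deviate from price `0`). -/
noncomputable def theta [DecidableEq M] (G : PCGame N M) (p : M → ℝ) (j : M) : ℝ :=
  sSup {u : ℝ | ∃ (p' : ℝ) (y : N → M → ℝ), G.c j ≤ p' ∧ (j = G.abstain → p' = 0) ∧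
    G.IsAssignment y ∧ G.Consistent y (Function.update p j p') ∧
    u = G.util y (Function.update p j p') j}

/-- The minimum subsidy that makes vendor `j` not want to deviate from `(x, p)`. -/
noncomputable def subsidy [DecidableEq M] (G : PCGame N M) (x : N → M → ℝ) (p : M → ℝ)
    (j : M) : ℝ :=
  G.theta p j - G.util x p j

end PCGame

namespace PCGame

section Deviation

variable {N M : Type} [Fintype N] [Fintype M]

lemma IsAssignment.le_volume {G : PCGame N M} {x : N → M → ℝ} (hx : G.IsAssignment x)
    (i : N) (j : M) : x i j ≤ G.μ i :=
  hx.2 i ▸ Finset.single_le_sum (fun k _ => hx.1 i k) (Finset.mem_univ j)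

lemma IsAssignment.add_le_volume [DecidableEq M] {G : PCGame N M} {x : N → M → ℝ}
    (hx : G.IsAssignment x) (i : N) {j k : M} (hjk : j ≠ k) : x i j + x i k ≤ G.μ i := by
  rw [← hx.2 i, ← Finset.sum_pair hjk]
  exact Finset.sum_le_univ_sum_of_nonneg (hx.1 i)

/-- In an equilibrium, vendor `j` earns at least what it would get by posting the price `q` and
serving completely every buyer type in `S`, provided `j` is then a best choice for these types. -/
lemma IsEquilibrium.deviation_le_util [DecidableEq M] {G : PCGame N M}
    {x : N → M → ℝ} {p : M → ℝ} (h : G.IsEquilibrium x p) {j : M} (hj : j ≠ G.abstain)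
    {q : ℝ} (hq : G.c j ≤ q) (S : Finset N)
    (hS : ∀ i ∈ S, ∀ k, k ≠ j → G.v i k - p k ≤ G.v i j - q) :
    (q - G.c j) * ∑ i ∈ S, G.μ i ≤ G.util x p j := by
  classical
  have hbest : ∀ i, ∃ k, (i ∈ S → k = j) ∧
      ∀ k', G.v i k' - Function.update p j q k' ≤ G.v i k - Function.update p j q k := by
    intro i
    by_cases hi : i ∈ S
    · refine ⟨j, fun _ => rfl, fun k' => ?_⟩
      by_cases hk : k' = j
      · rw [hk]
      · simpa [hk] using hS i hi k' hk
    · have : Nonempty M := ⟨j⟩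
      obtain ⟨k, hk⟩ := Finite.exists_max fun k => G.v i k - Function.update p j q k
      exact ⟨k, fun hi' => absurd hi' hi, hk⟩
  choose k hkS hk using hbest
  have hy := h.2.2.2 j hj q hq (fun i => Pi.single (k i) (G.μ i))
    ⟨fun i m => by
      by_cases hm : m = k i
      · subst hm; simpa using (G.μ_pos i).le
      · simp [hm], fun i => by simp⟩
    (fun i m hm => by
      by_cases hmk : m = k i
      · subst hmk; exact hk i
      · simp [hmk] at hm)
  refine le_trans ?_ hy
  simp only [util, Function.update_self]
  refine mul_le_mul_of_nonneg_left ?_ (sub_nonneg.2 hq)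
  calc ∑ i ∈ S, G.μ i = ∑ i ∈ S, (Pi.single (k i) (G.μ i) : M → ℝ) j :=
        Finset.sum_congr rfl fun i hi => by simp [hkS i hi]
    _ ≤ ∑ i, (Pi.single (k i) (G.μ i) : M → ℝ) j :=
        Finset.sum_le_univ_sum_of_nonneg fun i => by
          by_cases hm : j = k i
          · simpa [← hm] using (G.μ_pos i).le
          · simp [hm]

end Deviation

section TwoVendors

variable {G : PCGame Bool (Fin 3)} {x : Bool → Fin 3 → ℝ} {p : Fin 3 → ℝ} {t : Bool} {j k : Fin 3}

/-- Vendor `j` can sell to its favouring type `t` at any price `q` that is at most `5` and at most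
`2` above the price of its competitor `k`. -/
lemma IsEquilibrium.favoured_price_le_util (h : G.IsEquilibrium x p) (hab : G.abstain = 0)
    (hμ : ∀ i, G.μ i = 1) (hc : ∀ j, G.c j = 0) (hj : j ≠ 0) (hk : k ≠ 0) (hjk : j ≠ k)
    (htj : G.v t j = 5) (htk : G.v t k = 3) {q : ℝ} (hq : 0 ≤ q) (hq5 : q ≤ 5)
    (hqk : q ≤ p k + 2) : q ≤ G.util x p j := by
  have hp0 : p 0 = 0 := hab ▸ h.1.2
  have hv0 : G.v t 0 = 0 := hab ▸ G.v_abstain t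
  have := h.deviation_le_util (hab ▸ hj) (q := q) (by rwa [hc]) {t} (by
    intro i hi m hm
    rw [Finset.mem_singleton.1 hi]
    have : m = 0 ∨ m = k := by omega
    rcases this with rfl | rfl <;> linarith)
  simpa [hc, hμ] using this

/-- In an equilibrium no buyer type buys from the vendor it values less. -/
lemma IsEquilibrium.unfavoured_sales_eq_zero (h : G.IsEquilibrium x p) (hab : G.abstain = 0)
    (hμ : ∀ i, G.μ i = 1) (hc : ∀ j, G.c j = 0) (hj : j ≠ 0) (hk : k ≠ 0) (hjk : j ≠ k)
    (htj : G.v t j = 5) (htk : G.v t k = 3) (hsj : G.v (!t) j = 3) (hsk : G.v (!t) k = 5) :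
    x (!t) j = 0 := by
  obtain ⟨⟨hp, hp0⟩, hx, hcons, -⟩ := id h
  have hpj : 0 ≤ p j := hc j ▸ hp j
  have hv0 := G.v_abstain (!t)
  by_contra hne
  have hpos : 0 < x (!t) j := lt_of_le_of_ne (hx.1 _ _) (Ne.symm hne)
  have hjk_price := hcons _ _ hpos k
  have hj_price := hcons _ _ hpos G.abstain
  have htk0 : x t k = 0 := by
    by_contra hne'
    have := hcons _ _ (lt_of_le_of_ne (hx.1 _ _) (Ne.symm hne')) j
    linarith
  have hdev := h.favoured_price_le_util hab hμ hc hk hj hjk.symm hsk hsj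
    (q := p j + 2) (by linarith) (by linarith) le_rfl
  have hutil : G.util x p k = p k * x (!t) k := by
    cases t <;> simp_all [util]
  rw [hutil] at hdev
  have hspos : 0 < x (!t) k := by
    refine lt_of_le_of_ne (hx.1 _ _) fun h0 => ?_
    rw [← h0] at hdev
    linarith
  have hkj_price := hcons _ _ hspos j
  have hsum := hμ (!t) ▸ hx.add_le_volume (!t) hjk
  have hpk : p k = p j + 2 := by linarith
  rw [hpk] at hdev
  nlinarith

/-- In an equilibrium each vendor charges at most `5`, and at least as much as it could charge its
favouring type against the price of its competitor. -/
lemma IsEquilibrium.price_bounds (h : G.IsEquilibrium x p) (hab : G.abstain = 0)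
    (hμ : ∀ i, G.μ i = 1) (hc : ∀ j, G.c j = 0) (hj : j ≠ 0) (hk : k ≠ 0) (hjk : j ≠ k)
    (htj : G.v t j = 5) (htk : G.v t k = 3) (hsj : G.v (!t) j = 3) (hsk : G.v (!t) k = 5) :
    G.util x p j ≤ p j ∧ p j ≤ 5 ∧ min 5 (p k + 2) ≤ p j := by
  have hzero := h.unfavoured_sales_eq_zero hab hμ hc hj hk hjk htj htk hsj hsk
  obtain ⟨⟨hp, hp0⟩, hx, hcons, -⟩ := id h
  have hpj : 0 ≤ p j := hc j ▸ hp j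
  have hpk : 0 ≤ p k := hc k ▸ hp k
  have hv0 := G.v_abstain t
  have hmin : 2 ≤ min 5 (p k + 2) := le_min (by norm_num) (by linarith)
  have hdev := h.favoured_price_le_util hab hμ hc hj hk hjk htj htk
    (q := min 5 (p k + 2)) (by linarith) (min_le_left _ _) (min_le_right _ _)
  have hutil : G.util x p j = p j * x t j := by
    cases t <;> simp_all [util]
  have hle : G.util x p j ≤ p j :=
    hutil ▸ mul_le_of_le_one_right hpj (hμ t ▸ hx.le_volume t j)
  have hpos : 0 < x t j := by
    refine lt_of_le_of_ne (hx.1 _ _) fun h0 => ?_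
    rw [hutil, ← h0] at hdev
    linarith
  have hbuy := hcons _ _ hpos G.abstain
  exact ⟨hle, by linarith, hdev.trans hle⟩

end TwoVendors

end PCGame

/-- the 2-buyer-type, 2-vendor game with valuations 5/3 admits no
equilibrium.  Buyer `true` is the left type, buyer `false` is the right type;
vendor `0` is the abstain option, vendor `1` is the left vendor, vendor `2` is
the right vendor. -/
theorem stmt5 (G : PCGame Bool (Fin 3))
    (hab : G.abstain = 0)
    (hμ : ∀ i, G.μ i = 1)
    (hc : ∀ j, G.c j = 0)
    (hvll : G.v true 1 = 5) (hvlr : G.v true 2 = 3)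
    (hvrl : G.v false 1 = 3) (hvrr : G.v false 2 = 5) :
    ¬ ∃ (x : Bool → Fin 3 → ℝ) (p : Fin 3 → ℝ), G.IsEquilibrium x p := by
  rintro ⟨x, p, h⟩
  obtain ⟨hu, h1le, h1ge⟩ := h.price_bounds (t := true) (j := 1) (k := 2) hab hμ hc
    (by decide) (by decide) (by decide) hvll hvlr hvrl hvrr
  obtain ⟨-, h2le, h2ge⟩ := h.price_bounds (t := false) (j := 2) (k := 1) hab hμ hc
    (by decide) (by decide) (by decide) hvrr hvrl hvlr hvll
  have h2 : p 2 = 5 := by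
    rcases min_le_iff.1 h1ge with h' | h' <;> rcases min_le_iff.1 h2ge with h'' | h'' <;> linarith
  have hp0 : p 0 = 0 := hab ▸ h.1.2
  have hv0 : ∀ i, G.v i 0 = 0 := fun i => hab ▸ G.v_abstain i
  have hdev := h.deviation_le_util (j := 1) (q := 3) (by rw [hab]; decide) (by rw [hc]; norm_num)
    Finset.univ (by
      intro i _ m hm
      have hm' : m = 0 ∨ m = 2 := by omega
      have hi := hv0 i
      cases i <;> rcases hm' with rfl | rfl <;> linarith)
  norm_num [hc, hμ] at hdev
  linarith
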